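/- For each linearly unstable equilibrium point x of F, the vertex occupation measure process satisfies ℙ( lim_{n→∞} X(n) = x ) = 0. -/

import Mathlib

open Filter MeasureTheory

def simplexD (d m : ℕ) : Set (Fin m → Fin d → ℝ) :=
  {x | ∀ i, (∀ v, 0 ≤ x i v) ∧ (∑ v, x i v) = 1}

noncomputable def piMap (d m : ℕ) (α : Fin d → Fin m → Fin m → ℝ)
    (x : Fin m → Fin d → ℝ) : Fin m → Fin d → ℝ :=
  fun i v => Real.exp (∑ j, α v i j * x j v) / ∑ u, Real.exp (∑ j, α u i j * x j u)

noncomputable def FF (d m : ℕ) (α : Fin d → Fin m → Fin m → ℝ)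
    (x : Fin m → Fin d → ℝ) : Fin m → Fin d → ℝ :=
  fun i v => -(x i v) + piMap d m α x i v

/-- The Jacobian matrix of `F` at `x`, with rows and columns indexed by pairs `(i, v)`:
entry `((i,v), (j,u))` is the partial derivative of `F_v^i` in the direction of the
coordinate `x_u^j`. -/
noncomputable def JF (d m : ℕ) (α : Fin d → Fin m → Fin m → ℝ)
    (x : Fin m → Fin d → ℝ) : Matrix (Fin m × Fin d) (Fin m × Fin d) ℝ :=
  Matrix.of fun p q =>
    fderiv ℝ (fun y => FF d m α y p.1 p.2) x (Pi.single q.1 (Pi.single q.2 (1 : ℝ)))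

/-- `x` is a linearly unstable (hyperbolic) equilibrium: `JF(x)` has no eigenvalue with
zero real part and has some eigenvalue with positive real part. -/
noncomputable def LinUnstable (d m : ℕ) (α : Fin d → Fin m → Fin m → ℝ)
    (x : Fin m → Fin d → ℝ) : Prop :=
  (∀ μ ∈ spectrum ℂ ((JF d m α x).map (algebraMap ℝ ℂ)), μ.re ≠ 0) ∧
    (∃ μ ∈ spectrum ℂ ((JF d m α x).map (algebraMap ℝ ℂ)), 0 < μ.re)

noncomputable def occ (d m : ℕ) {Ω : Type*} (W : ℕ → Ω → Fin m → Fin d)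
    (n : ℕ) (ω : Ω) : Fin m → Fin d → ℝ :=
  fun i v => (1 + ∑ k ∈ Finset.Icc 1 n, if W k ω i = v then (1 : ℝ) else 0) / (d + n)

/-- An exponential moment estimate for one step of a process that is locally expanded, and
excited by the noise, with respect to a (possibly indefinite) quadratic form. -/
lemma exists_exp_quadratic_step {E : Type*} [NormedAddCommGroup E] [NormedSpace ℝ E]
    (B : E →L[ℝ] E →L[ℝ] ℝ) (hB : ∀ y z, B y z = B z y) {c : ℝ} (hc : 0 < c) :
    ∃ θ > 0, ∀ {ι : Type} [Fintype ι] (p : ι → ℝ) (Z : E) (η : ι → E) (γ s : ℝ),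
      (∀ i, 0 ≤ p i) → ∑ i, p i = 1 → ‖Z‖ ≤ 1 → (∀ i, ‖η i‖ ≤ 2) →
      c * ‖Z‖ ^ 2 ≤ ∑ i, p i * B Z (η i) → c ≤ ∑ i, p i * B (η i) (η i) →
      0 ≤ γ → γ ≤ 1 → 0 ≤ s → s * γ ≤ 1 →
      ∑ i, p i * Real.exp (-(θ * s * B (Z + γ • η i) (Z + γ • η i)))
        ≤ Real.exp (-(θ * c / 2 * s * γ ^ 2)) * Real.exp (-(θ * s * B Z Z)) := by
  set C : ℝ := 4 * ‖B‖ + 1 with hC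
  have hCpos : 0 < C := by positivity
  refine ⟨min (1 / (3 * C)) (c / (4 * C ^ 2)), by positivity, ?_⟩
  set θ := min (1 / (3 * C)) (c / (4 * C ^ 2)) with hθ
  have hθpos : 0 < θ := by positivity
  have hθ1 : θ * (3 * C) ≤ 1 := by
    rw [← le_div_iff₀ (by positivity)]; exact min_le_left _ _
  have hθ2 : θ * (4 * C ^ 2) ≤ c := by
    rw [← le_div_iff₀ (by positivity)]; exact min_le_right _ _
  clear_value θ
  intro ι _ p Z η γ s hp hp1 hZ hη h1 h2 hγ0 hγ1 hs hsγ
  set u : ι → ℝ := fun i => θ * s * (2 * γ * B Z (η i) + γ ^ 2 * B (η i) (η i)) with hu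
  have hsplit : ∀ i, -(θ * s * B (Z + γ • η i) (Z + γ • η i))
      = -(θ * s * B Z Z) + -(u i) := by
    intro i
    simp only [hu, map_add, map_smul, add_apply,
      smul_apply, smul_eq_mul, hB (η i) Z]
    ring
  have hb1 : ∀ i, |B Z (η i)| ≤ C * ‖Z‖ := by
    intro i
    have := B.le_opNorm₂ Z (η i)
    rw [Real.norm_eq_abs] at this
    have h3 : ‖B‖ * ‖Z‖ * ‖η i‖ ≤ ‖B‖ * ‖Z‖ * 2 := by gcongr; exact hη i
    nlinarith [norm_nonneg Z, norm_nonneg B, mul_nonneg (norm_nonneg B) (norm_nonneg Z)]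
  have hb2 : ∀ i, |B (η i) (η i)| ≤ C := by
    intro i
    have := B.le_opNorm₂ (η i) (η i)
    rw [Real.norm_eq_abs] at this
    have h3 : ‖B‖ * ‖η i‖ * ‖η i‖ ≤ ‖B‖ * 2 * 2 := by gcongr <;> exact hη i
    linarith
  have hsum : ∀ i, |2 * γ * B Z (η i) + γ ^ 2 * B (η i) (η i)|
      ≤ γ * (C * (2 * ‖Z‖ + γ)) := by
    intro i
    calc _ ≤ |2 * γ * B Z (η i)| + |γ ^ 2 * B (η i) (η i)| := abs_add_le _ _
      _ = 2 * γ * |B Z (η i)| + γ ^ 2 * |B (η i) (η i)| := by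
        rw [abs_mul (2 * γ), abs_mul (γ ^ 2), abs_of_nonneg (by positivity : 0 ≤ 2 * γ),
          abs_of_nonneg (by positivity : 0 ≤ γ ^ 2)]
      _ ≤ 2 * γ * (C * ‖Z‖) + γ ^ 2 * C := by gcongr; exacts [hb1 i, hb2 i]
      _ = _ := by ring
  have hu1 : ∀ i, |u i| ≤ θ * (s * γ) * (C * (2 * ‖Z‖ + γ)) := by
    intro i
    simp only [hu]
    rw [abs_mul, abs_of_nonneg (by positivity : 0 ≤ θ * s)]
    calc _ ≤ θ * s * (γ * (C * (2 * ‖Z‖ + γ))) := by gcongr; exact hsum i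
      _ = _ := by ring
  have hu2 : ∀ i, |u i| ≤ 1 := by
    intro i
    refine (hu1 i).trans ?_
    calc _ ≤ θ * 1 * (C * (2 * 1 + 1)) := by gcongr
      _ ≤ 1 := by linarith
  have hu3 : ∀ i, u i ^ 2 ≤ θ ^ 2 * (s * γ) * (C ^ 2 * (8 * ‖Z‖ ^ 2 + 2 * γ ^ 2)) := by
    intro i
    rw [← sq_abs]
    calc _ ≤ (θ * (s * γ) * (C * (2 * ‖Z‖ + γ))) ^ 2 := by gcongr; exact hu1 i
      _ = θ ^ 2 * (s * γ) * (s * γ) * C ^ 2 * (2 * ‖Z‖ + γ) ^ 2 := by ring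
      _ ≤ θ ^ 2 * (s * γ) * 1 * C ^ 2 * (8 * ‖Z‖ ^ 2 + 2 * γ ^ 2) := by
        gcongr
        nlinarith [sq_nonneg (2 * ‖Z‖ - γ)]
      _ = _ := by ring
  have hexp : ∀ i, Real.exp (-(u i)) ≤ 1 - u i + u i ^ 2 := by
    intro i
    have := Real.abs_exp_sub_one_sub_id_le (x := -(u i)) (by rw [abs_neg]; exact hu2 i)
    have := (abs_le.1 this).2
    nlinarith
  have hEu : ∑ i, p i * u i = θ * s * (2 * γ * ∑ i, p i * B Z (η i)
      + γ ^ 2 * ∑ i, p i * B (η i) (η i)) := by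
    simp only [hu, Finset.mul_sum, ← Finset.sum_add_distrib]
    exact Finset.sum_congr rfl fun i _ => by ring
  have hEu' : θ * s * (2 * γ * (c * ‖Z‖ ^ 2) + γ ^ 2 * c) ≤ ∑ i, p i * u i := by
    rw [hEu]; gcongr
  have hEu2 : ∑ i, p i * u i ^ 2
      ≤ θ ^ 2 * (s * γ) * (C ^ 2 * (8 * ‖Z‖ ^ 2 + 2 * γ ^ 2)) := by
    calc _ ≤ ∑ i, p i * (θ ^ 2 * (s * γ) * (C ^ 2 * (8 * ‖Z‖ ^ 2 + 2 * γ ^ 2))) := by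
          gcongr with i; exacts [hp i, hu3 i]
      _ = _ := by rw [← Finset.sum_mul, hp1, one_mul]
  have hcmp : θ ^ 2 * (s * γ) * (C ^ 2 * (8 * ‖Z‖ ^ 2 + 2 * γ ^ 2))
      ≤ θ * (s * γ) * (2 * c * ‖Z‖ ^ 2 + c / 2 * γ) := by
    calc _ = θ * (s * γ) * (θ * (4 * C ^ 2) * (2 * ‖Z‖ ^ 2 + γ * γ / 2)) := by ring
      _ ≤ θ * (s * γ) * (c * (2 * ‖Z‖ ^ 2 + γ * 1 / 2)) := by gcongr
      _ = _ := by ring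
  calc ∑ i, p i * Real.exp (-(θ * s * B (Z + γ • η i) (Z + γ • η i)))
      = (∑ i, p i * Real.exp (-(u i))) * Real.exp (-(θ * s * B Z Z)) := by
        rw [Finset.sum_mul]
        refine Finset.sum_congr rfl fun i _ => ?_
        rw [hsplit, Real.exp_add]; ring
    _ ≤ Real.exp (-(θ * c / 2 * s * γ ^ 2)) * Real.exp (-(θ * s * B Z Z)) := by
        gcongr
        calc _ ≤ ∑ i, p i * (1 - u i + u i ^ 2) := by
              gcongr with i; exacts [hp i, hexp i]
          _ = 1 - ∑ i, p i * u i + ∑ i, p i * u i ^ 2 := by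
              simp only [mul_add, mul_sub, mul_one, Finset.sum_sub_distrib,
                Finset.sum_add_distrib, hp1]
          _ ≤ -(θ * c / 2 * s * γ ^ 2) + 1 := by nlinarith
          _ ≤ _ := Real.add_one_le_exp _

/-- Integrating out a finitely valued random variable `V` against its conditional law. -/
lemma setLIntegral_eq_sum_condLaw {Ω S : Type*} {m mΩ : MeasurableSpace Ω} (hm : m ≤ mΩ)
    (μ : Measure Ω) [IsFiniteMeasure μ] [Fintype S] [DecidableEq S] [MeasurableSpace S]
    [MeasurableSingletonClass S] {V : Ω → S} (hV : Measurable V) {q : Ω → S → ℝ}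
    (hq : ∀ w, Measurable[m] fun ω => q ω w) (hq0 : ∀ ω w, 0 ≤ q ω w)
    (hcond : ∀ w, μ[fun ω => if V ω = w then (1 : ℝ) else 0 | m] =ᵐ[μ] fun ω => q ω w)
    {A : Set Ω} (hA : MeasurableSet[m] A) (h : S → Ω → ENNReal) (hh : ∀ w, Measurable[m] (h w)) :
    ∫⁻ ω in A, h (V ω) ω ∂μ = ∫⁻ ω in A, ∑ w, ENNReal.ofReal (q ω w) * h w ω ∂μ := by
  have hV' : ∀ w, MeasurableSet {ω | V ω = w} := fun w => hV (measurableSet_singleton w)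
  have htrim : ∀ w, (μ.restrict {ω | V ω = w}).trim hm
      = (μ.withDensity fun ω => ENNReal.ofReal (q ω w)).trim hm := by
    intro w
    refine @Measure.ext _ m _ _ fun T hT => ?_
    rw [trim_measurableSet_eq hm hT, trim_measurableSet_eq hm hT,
      Measure.restrict_apply (hm _ hT), withDensity_apply _ (hm _ hT)]
    have h2 : (fun ω => if V ω = w then (1 : ℝ) else 0)
        = {ω | V ω = w}.indicator fun _ => (1 : ℝ) := by
      ext ω; simp [Set.indicator_apply]
    have hi : Integrable (fun ω => if V ω = w then (1 : ℝ) else 0) μ :=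
      h2 ▸ (integrable_const (1 : ℝ)).indicator (hV' w)
    have hqi : Integrable (fun ω => q ω w) μ := integrable_condExp.congr (hcond w)
    have h1 := setIntegral_condExp hm hi hT
    rw [setIntegral_congr_ae (hm _ hT) ((hcond w).mono fun ω hω _ => hω)] at h1
    rw [← ofReal_integral_eq_lintegral_ofReal hqi.integrableOn
      (Eventually.of_forall fun ω => hq0 ω w), h1]
    rw [h2, setIntegral_indicator (hV' w), setIntegral_const, smul_eq_mul, mul_one,
      ofReal_measureReal]
  have key : ∀ w, ∫⁻ ω in A, {ω | V ω = w}.indicator (h w) ω ∂μ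
      = ∫⁻ ω in A, ENNReal.ofReal (q ω w) * h w ω ∂μ := by
    intro w
    have hk : Measurable[m] (A.indicator (h w)) := (hh w).indicator hA
    calc ∫⁻ ω in A, {ω | V ω = w}.indicator (h w) ω ∂μ
        = ∫⁻ ω, A.indicator (h w) ω ∂(μ.restrict {ω | V ω = w}) := by
          rw [lintegral_indicator (hV' w), lintegral_indicator (hm _ hA),
            Measure.restrict_restrict (hV' w), Measure.restrict_restrict (hm _ hA),
            Set.inter_comm]
      _ = ∫⁻ ω, A.indicator (h w) ω ∂(μ.withDensity fun ω => ENNReal.ofReal (q ω w)) := by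
          rw [← lintegral_trim hm hk, htrim w, lintegral_trim hm hk]
      _ = _ := by
          rw [lintegral_withDensity_eq_lintegral_mul _
            ((hq w).mono hm le_rfl).ennreal_ofReal (hk.mono hm le_rfl),
            ← lintegral_indicator (hm _ hA)]
          refine lintegral_congr fun ω => ?_
          by_cases hω : ω ∈ A <;> simp [hω]
  calc ∫⁻ ω in A, h (V ω) ω ∂μ
      = ∫⁻ ω in A, ∑ w, {ω | V ω = w}.indicator (h w) ω ∂μ := by
        refine lintegral_congr fun ω => ?_
        simp [Set.indicator_apply]
    _ = ∑ w, ∫⁻ ω in A, {ω | V ω = w}.indicator (h w) ω ∂μ :=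
        lintegral_finsetSum _ fun w _ => ((hh w).mono hm le_rfl).indicator (hV' w)
    _ = ∑ w, ∫⁻ ω in A, ENNReal.ofReal (q ω w) * h w ω ∂μ := by simp_rw [key]
    _ = _ := (lintegral_finsetSum _ fun w _ =>
        ((hq w).mono hm le_rfl).ennreal_ofReal.mul ((hh w).mono hm le_rfl)).symm

/-- The same for two independent copies. -/
lemma setLIntegral_setLIntegral_eq_sum_condLaw {Ω S E : Type*} {m mΩ : MeasurableSpace Ω}
    (hm : m ≤ mΩ) (μ : Measure Ω) [IsFiniteMeasure μ] [Fintype S] [DecidableEq S]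
    [MeasurableSpace S] [MeasurableSingletonClass S] [MeasurableSpace E] {V : Ω → S}
    (hV : Measurable V) {X : Ω → E} (hX : Measurable[m] X) {p : E → S → ℝ}
    (hp : ∀ w, Measurable fun y => p y w) (hp0 : ∀ y w, 0 ≤ p y w)
    (hcond : ∀ w, μ[fun ω => if V ω = w then (1 : ℝ) else 0 | m] =ᵐ[μ] fun ω => p (X ω) w)
    {A : Set Ω} (hA : MeasurableSet[m] A) (g : S → E → E) (hg : ∀ w, Measurable (g w))
    (Φ : E × E → ENNReal) (hΦ : Measurable Φ) :
    ∫⁻ ω in A, ∫⁻ ω' in A, Φ (g (V ω) (X ω), g (V ω') (X ω')) ∂μ ∂μ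
      = ∫⁻ ω' in A, ∫⁻ ω in A, ∑ w, ENNReal.ofReal (p (X ω) w) *
          ∑ w', ENNReal.ofReal (p (X ω') w') * Φ (g w (X ω), g w' (X ω')) ∂μ ∂μ := by
  have hX' : Measurable X := hX.mono hm le_rfl
  have hg' : Measurable fun z : S × E => g z.1 z.2 := measurable_from_prod_countable_right hg
  have hq : ∀ w, Measurable[m] fun ω => p (X ω) w := fun w => (hp w).comp hX
  have h1 : ∀ y : E, ∫⁻ ω' in A, Φ (y, g (V ω') (X ω')) ∂μ
      = ∫⁻ ω' in A, ∑ w', ENNReal.ofReal (p (X ω') w') * Φ (y, g w' (X ω')) ∂μ := fun y =>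
    setLIntegral_eq_sum_condLaw hm μ hV hq (fun ω w => hp0 _ w) hcond hA
      (fun w ω => Φ (y, g w (X ω)))
      fun w => (hΦ.comp (measurable_const.prodMk (hg w))).comp hX
  simp_rw [h1]
  rw [lintegral_lintegral_swap]
  · refine lintegral_congr fun ω' => ?_
    refine setLIntegral_eq_sum_condLaw hm μ hV hq (fun ω w => hp0 _ w) hcond hA
      (fun w ω => ∑ w', ENNReal.ofReal (p (X ω') w') * Φ (g w (X ω), g w' (X ω'))) fun w => ?_
    have : Measurable fun y => ∑ w', ENNReal.ofReal (p (X ω') w') * Φ (g w y, g w' (X ω')) :=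
      Finset.measurable_sum _ fun w' _ =>
        (hΦ.comp ((hg w).prodMk measurable_const)).const_mul _
    exact this.comp hX
  · refine Measurable.aemeasurable ?_
    refine Finset.measurable_sum _ fun w' _ => ?_
    refine Measurable.mul ?_ (hΦ.comp ?_)
    · exact ((hp w').comp (hX'.comp measurable_snd)).ennreal_ofReal
    · exact (hg'.comp ((hV.comp measurable_fst).prodMk (hX'.comp measurable_fst))).prodMk
        ((hg w').comp (hX'.comp measurable_snd))

/-- Two independent copies of the process started from the same point at time `s` cannot both
converge to the same limit, while staying in `N`, with probability close to one. -/
lemma exists_measure_stay_converge_le {Ω E : Type*} {S : Type} {mΩ : MeasurableSpace Ω}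
    [NormedAddCommGroup E] [NormedSpace ℝ E]
    [MeasurableSpace E] [BorelSpace E] [SecondCountableTopology E]
    [Fintype S] [DecidableEq S] [MeasurableSpace S] [MeasurableSingletonClass S]
    (μ : Measure Ω) [IsFiniteMeasure μ] (ℱ : Filtration ℕ mΩ)
    {W : ℕ → Ω → S} (hW : ∀ n, Measurable (W n))
    {X : ℕ → Ω → E} (hX : ∀ n, Measurable[ℱ n] (X n)) {p : E → S → ℝ}
    (hp : ∀ w, Measurable fun y => p y w) (hp0 : ∀ y w, 0 ≤ p y w) (hp1 : ∀ y, ∑ w, p y w = 1)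
    (hcond : ∀ n w, μ[fun ω => if W (n + 1) ω = w then (1 : ℝ) else 0 | ℱ n]
      =ᵐ[μ] fun ω => p (X n ω) w)
    (ξ : S → E) (D : ℝ) (hD : 0 ≤ D)
    (hstep : ∀ (n : ℕ) ω, X (n + 1) ω
      = X n ω + (1 / (D + n + 1)) • (ξ (W (n + 1) ω) - X n ω))
    (hξ : ∀ w w', ‖ξ w - ξ w'‖ ≤ 1) (hX1 : ∀ n ω ω', ‖X n ω - X n ω'‖ ≤ 1)
    (B : E →L[ℝ] E →L[ℝ] ℝ) (hB : ∀ y z, B y z = B z y) {c : ℝ} (hc : 0 < c)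
    {N : Set E} (hN : MeasurableSet N)
    (h1 : ∀ n ω ω', X n ω ∈ N → X n ω' ∈ N → c * ‖X n ω - X n ω'‖ ^ 2
      ≤ ∑ z : S × S, p (X n ω) z.1 * p (X n ω') z.2 *
        B (X n ω - X n ω') (ξ z.1 - ξ z.2 - (X n ω - X n ω')))
    (h2 : ∀ n ω ω', X n ω ∈ N → X n ω' ∈ N → c
      ≤ ∑ z : S × S, p (X n ω) z.1 * p (X n ω') z.2 *
        B (ξ z.1 - ξ z.2 - (X n ω - X n ω')) (ξ z.1 - ξ z.2 - (X n ω - X n ω'))) :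
    ∃ q : ℝ, 0 ≤ q ∧ q < 1 ∧ ∀ (s : ℕ) (A F : Set Ω) (y x : E), 1 ≤ s → MeasurableSet[ℱ s] A →
      MeasurableSet F → F ⊆ A → (∀ ω ∈ A, X s ω = y) → (∀ ω ∈ F, ∀ k, s ≤ k → X k ω ∈ N) →
      (∀ ω ∈ F, Tendsto (fun n => X n ω) atTop (nhds x)) →
      μ F ≤ ENNReal.ofReal q * μ A := by
  obtain ⟨θ, hθ, hθstep⟩ := exists_exp_quadratic_step B hB hc
  have hX' : ∀ n, Measurable (X n) := fun n => (hX n).mono (ℱ.le n) le_rfl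
  set κ : ℝ := θ * c / 2 with hκ
  have hκpos : 0 < κ := by positivity
  refine ⟨Real.exp (-(κ / (2 * (D + 2)))), (Real.exp_pos _).le, ?_, ?_⟩
  · rw [Real.exp_lt_one_iff]
    have : 0 < κ / (2 * (D + 2)) := by positivity
    linarith
  intro s A F y x hs hA hF hFA hAy hFN hFx
  have hs1 : (1 : ℝ) ≤ s := by exact_mod_cast hs
  set Φ : E × E → ENNReal := fun z =>
    ENNReal.ofReal (Real.exp (-(θ * s * B (z.1 - z.2) (z.1 - z.2)))) with hΦdef
  have hΦc : Continuous Φ := by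
    have : Continuous fun v : E => B v v := by fun_prop
    refine ENNReal.continuous_ofReal.comp (Real.continuous_exp.comp ?_)
    exact (continuous_const.mul (this.comp (continuous_fst.sub continuous_snd))).neg
  have hΦ : Measurable Φ := hΦc.measurable
  have hΦsymm : ∀ a b, Φ (a, b) = Φ (b, a) := by
    intro a b
    simp only [hΦdef]
    rw [← neg_sub b a]
    simp only [map_neg, neg_apply, neg_neg]
  set Ak : ℕ → Set Ω := fun k => A ∩ ⋂ j ∈ Finset.Icc s k, X j ⁻¹' N with hAk
  have hAkm : ∀ k, s ≤ k → MeasurableSet[ℱ k] (Ak k) := by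
    intro k hk
    refine MeasurableSet.inter (ℱ.mono hk _ hA) ?_
    refine Finset.measurableSet_biInter _ fun j hj => ?_
    exact ℱ.mono (Finset.mem_Icc.1 hj).2 _ (hX j hN)
  have hAkN : ∀ k, s ≤ k → ∀ ω ∈ Ak k, X k ω ∈ N := by
    intro k hk ω hω
    have := hω.2
    simp only [Set.mem_iInter, Finset.mem_Icc] at this
    exact this k ⟨hk, le_rfl⟩
  have hAkmono : ∀ k, Ak (k + 1) ⊆ Ak k := by
    intro k
    refine Set.inter_subset_inter_right _ (Set.biInter_mono ?_ fun _ _ => le_rfl)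
    intro j hj
    simp only [Finset.coe_Icc, Set.mem_Icc] at hj ⊢
    omega
  have hFAk : ∀ k, F ⊆ Ak k := by
    intro k ω hω
    refine ⟨hFA hω, ?_⟩
    simp only [Set.mem_iInter, Finset.mem_Icc]
    exact fun j hj => hFN ω hω j hj.1
  set I : ℕ → ENNReal := fun k =>
    ∫⁻ ω in Ak k, ∫⁻ ω' in Ak k, Φ (X k ω, X k ω') ∂μ ∂μ with hI
  have hIstep : ∀ k, s ≤ k →
      I (k + 1) ≤ ENNReal.ofReal (Real.exp (-(κ * s * (1 / (D + k + 1)) ^ 2))) * I k := by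
    intro k hk
    set γ : ℝ := 1 / (D + k + 1) with hγ
    have hsk : (s : ℝ) ≤ k := by exact_mod_cast hk
    have hγ0 : 0 ≤ γ := by positivity
    have hγ1 : γ ≤ 1 := by
      rw [hγ, div_le_one (by positivity)]; linarith
    have hsγ : s * γ ≤ 1 := by
      rw [hγ, mul_one_div, div_le_one (by positivity)]; linarith
    have hAm := ℱ.le k _ (hAkm k hk)
    calc I (k + 1)
        ≤ ∫⁻ ω in Ak k, ∫⁻ ω' in Ak k, Φ (X (k + 1) ω, X (k + 1) ω') ∂μ ∂μ :=
          lintegral_mono' (Measure.restrict_mono (hAkmono k) le_rfl) fun ω =>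
            lintegral_mono' (Measure.restrict_mono (hAkmono k) le_rfl) le_rfl
      _ = ∫⁻ ω' in Ak k, ∫⁻ ω in Ak k, ∑ w, ENNReal.ofReal (p (X k ω) w) *
          ∑ w', ENNReal.ofReal (p (X k ω') w') *
            Φ (X k ω + γ • (ξ w - X k ω), X k ω' + γ • (ξ w' - X k ω')) ∂μ ∂μ := by
          simp_rw [hstep k]
          exact setLIntegral_setLIntegral_eq_sum_condLaw (ℱ.le k) μ (hW (k + 1)) (hX k) hp hp0
            (hcond k) (hAkm k hk) (fun w v => v + γ • (ξ w - v)) (fun w => by fun_prop) Φ hΦ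
      _ ≤ ∫⁻ ω' in Ak k, ∫⁻ ω in Ak k, ENNReal.ofReal (Real.exp (-(κ * s * γ ^ 2))) *
            Φ (X k ω', X k ω) ∂μ ∂μ := by
          refine setLIntegral_mono' hAm fun ω' hω' => setLIntegral_mono' hAm fun ω hω => ?_
          set Z := X k ω - X k ω' with hZ
          have key := hθstep (ι := S × S) (fun z => p (X k ω) z.1 * p (X k ω') z.2) Z
            (fun z => ξ z.1 - ξ z.2 - Z) γ s (fun z => mul_nonneg (hp0 _ _) (hp0 _ _))
            (by rw [Fintype.sum_prod_type]; simp_rw [← Finset.mul_sum, hp1, mul_one, hp1])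
            (hX1 k ω ω')
            (fun z => (norm_sub_le _ _).trans
              (by linarith [hξ z.1 z.2, hX1 k ω ω']))
            (h1 k ω ω' (hAkN k hk ω hω) (hAkN k hk ω' hω'))
            (h2 k ω ω' (hAkN k hk ω hω) (hAkN k hk ω' hω')) hγ0 hγ1 (by positivity) hsγ
          have heq : ∑ w, ENNReal.ofReal (p (X k ω) w) * ∑ w', ENNReal.ofReal (p (X k ω') w') *
              Φ (X k ω + γ • (ξ w - X k ω), X k ω' + γ • (ξ w' - X k ω'))
              = ENNReal.ofReal (∑ z : S × S, p (X k ω) z.1 * p (X k ω') z.2 *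
                Real.exp (-(θ * s * B (Z + γ • (ξ z.1 - ξ z.2 - Z))
                  (Z + γ • (ξ z.1 - ξ z.2 - Z))))) := by
            rw [Fintype.sum_prod_type, ENNReal.ofReal_sum_of_nonneg fun w _ =>
              Finset.sum_nonneg fun w' _ => mul_nonneg
                (mul_nonneg (hp0 _ _) (hp0 _ _)) (Real.exp_pos _).le]
            refine Finset.sum_congr rfl fun w _ => ?_
            rw [Finset.mul_sum, ENNReal.ofReal_sum_of_nonneg fun w' _ => mul_nonneg
                (mul_nonneg (hp0 _ _) (hp0 _ _)) (Real.exp_pos _).le]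
            refine Finset.sum_congr rfl fun w' _ => ?_
            have hv : X k ω + γ • (ξ w - X k ω) - (X k ω' + γ • (ξ w' - X k ω'))
                = Z + γ • (ξ w - ξ w' - Z) := by
              rw [hZ]; module
            simp only [hΦdef]
            rw [hv, ENNReal.ofReal_mul (mul_nonneg (hp0 _ _) (hp0 _ _)),
              ENNReal.ofReal_mul (hp0 _ _), mul_assoc (ENNReal.ofReal _)]
          rw [heq, hΦsymm (X k ω') (X k ω)]
          simp only [hΦdef]
          rw [← ENNReal.ofReal_mul (Real.exp_pos _).le]
          exact ENNReal.ofReal_le_ofReal key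
      _ = _ := by
          have hm1 : ∀ ω', Measurable fun ω => Φ (X k ω', X k ω) := fun ω' =>
            hΦ.comp (measurable_const.prodMk (hX' k))
          simp_rw [fun ω' => lintegral_const_mul (μ := μ.restrict (Ak k))
            (ENNReal.ofReal (Real.exp (-(κ * s * γ ^ 2)))) (hm1 ω')]
          rw [lintegral_const_mul' _ _ ENNReal.ofReal_ne_top]
  have hIbound : ∀ k, s ≤ k → I k ≤ ENNReal.ofReal
      (Real.exp (-(κ * (s / (D + s + 1) - s / (D + k + 1))))) * (μ A * μ A) := by
    intro k hk
    induction k, hk using Nat.le_induction with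
    | base =>
      rw [sub_self, mul_zero, neg_zero, Real.exp_zero, ENNReal.ofReal_one, one_mul]
      calc I s ≤ ∫⁻ ω in Ak s, ∫⁻ ω' in Ak s, 1 ∂μ ∂μ := by
            have hAm := ℱ.le s _ (hAkm s le_rfl)
            refine setLIntegral_mono' hAm fun ω hω => setLIntegral_mono' hAm fun ω' hω' => ?_
            simp [hΦdef, hAy ω hω.1, hAy ω' hω'.1]
        _ = μ (Ak s) * μ (Ak s) := by simp
        _ ≤ μ A * μ A := by gcongr <;> exact Set.inter_subset_left
    | succ k hk ih =>
      refine (hIstep k hk).trans ?_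
      calc _ ≤ ENNReal.ofReal (Real.exp (-(κ * s * (1 / (D + k + 1)) ^ 2))) *
            (ENNReal.ofReal (Real.exp (-(κ * (s / (D + s + 1) - s / (D + k + 1)))))
              * (μ A * μ A)) := by gcongr
        _ ≤ _ := by
          rw [← mul_assoc, ← ENNReal.ofReal_mul (Real.exp_pos _).le, ← Real.exp_add]
          gcongr
          have hd : (1 / (D + k + 1) - 1 / (D + k + 2) : ℝ) ≤ (1 / (D + k + 1)) ^ 2 := by
            rw [div_sub_div _ _ (by positivity) (by positivity), div_pow,
              div_le_div_iff₀ (by positivity) (by positivity)]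
            nlinarith [show (0 : ℝ) ≤ D + k by positivity]
          have hd' := mul_le_mul_of_nonneg_left hd (by positivity : 0 ≤ κ * s)
          have e1 : (D + ((k + 1 : ℕ) : ℝ) + 1) = D + k + 2 := by push_cast; ring
          rw [e1]
          have e2 : κ * s * (1 / (D + k + 1) - 1 / (D + k + 2))
              = κ * (s / (D + k + 1)) - κ * (s / (D + k + 2)) := by ring
          rw [e2] at hd'
          linarith
  have hFatou : μ F * μ F ≤ liminf I atTop := by
    have hm1 : ∀ k ω, Measurable fun ω' => Φ (X k ω, X k ω') := fun k ω =>
      hΦ.comp (measurable_const.prodMk (hX' k))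
    have hm2 : ∀ k, Measurable fun ω => ∫⁻ ω' in F, Φ (X k ω, X k ω') ∂μ := fun k =>
      Measurable.lintegral_prod_right
        (hΦ.comp (((hX' k).comp measurable_fst).prodMk ((hX' k).comp measurable_snd)))
    calc μ F * μ F = ∫⁻ ω in F, ∫⁻ ω' in F, 1 ∂μ ∂μ := by simp
      _ = ∫⁻ ω in F, ∫⁻ ω' in F, liminf (fun k => Φ (X k ω, X k ω')) atTop ∂μ ∂μ := by
          refine setLIntegral_congr_fun hF fun ω hω => setLIntegral_congr_fun hF fun ω' hω' => ?_
          have ht := (hΦc.tendsto (x, x)).comp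
            ((hFx ω hω).prodMk_nhds (hFx ω' hω'))
          have hxx : Φ (x, x) = 1 := by simp [hΦdef]
          rw [hxx] at ht
          exact ht.liminf_eq.symm
      _ ≤ ∫⁻ ω in F, liminf (fun k => ∫⁻ ω' in F, Φ (X k ω, X k ω') ∂μ) atTop ∂μ :=
          lintegral_mono fun ω => lintegral_liminf_le fun k => hm1 k ω
      _ ≤ liminf (fun k => ∫⁻ ω in F, ∫⁻ ω' in F, Φ (X k ω, X k ω') ∂μ ∂μ) atTop :=
          lintegral_liminf_le hm2
      _ ≤ liminf I atTop := by
          refine liminf_le_liminf (Eventually.of_forall fun k => ?_)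
          exact lintegral_mono' (Measure.restrict_mono (hFAk k) le_rfl) fun ω =>
            lintegral_mono' (Measure.restrict_mono (hFAk k) le_rfl) le_rfl
  have hlim : Tendsto (fun k : ℕ => ENNReal.ofReal
      (Real.exp (-(κ * (s / (D + s + 1) - s / (D + k + 1))))) * (μ A * μ A)) atTop
      (nhds (ENNReal.ofReal (Real.exp (-(κ * (s / (D + s + 1) - 0)))) * (μ A * μ A))) := by
    refine ENNReal.Tendsto.mul_const ?_ (Or.inr (by finiteness))
    refine (ENNReal.continuous_ofReal.comp Real.continuous_exp).continuousAt.tendsto.comp ?_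
    refine ((tendsto_const_nhds.sub ?_).const_mul κ).neg
    refine Tendsto.const_div_atTop ?_ _
    exact tendsto_atTop_add_const_right _ _
      (tendsto_atTop_add_const_left _ _ tendsto_natCast_atTop_atTop)
  have hfin : μ F * μ F ≤ ENNReal.ofReal (Real.exp (-(κ / (D + 2)))) * (μ A * μ A) := by
    refine hFatou.trans ((liminf_le_liminf (eventually_atTop.2 ⟨s, hIbound⟩)).trans ?_)
    rw [hlim.liminf_eq]
    gcongr
    rw [sub_zero, div_eq_mul_inv]
    gcongr
    rw [inv_eq_one_div, div_le_div_iff₀ (by positivity) (by positivity)]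
    nlinarith
  have hsq : μ F ^ 2 ≤ (ENNReal.ofReal (Real.exp (-(κ / (2 * (D + 2))))) * μ A) ^ 2 := by
    rw [mul_pow, sq, sq (μ A), ← ENNReal.ofReal_pow (Real.exp_pos _).le, ← Real.exp_nat_mul]
    convert hfin using 5
    field_simp
    norm_num
  exact (ENNReal.pow_le_pow_left_iff (by norm_num)).1 hsq

/-- The process almost surely does not converge to a point having a neighbourhood in which
differences of the process are expanded and excited by the noise. -/
lemma measure_tendsto_eq_zero_of_expanding {Ω E : Type*} {S : Type} {mΩ : MeasurableSpace Ω}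
    [NormedAddCommGroup E] [NormedSpace ℝ E]
    [MeasurableSpace E] [BorelSpace E] [SecondCountableTopology E]
    [Fintype S] [DecidableEq S] [MeasurableSpace S] [MeasurableSingletonClass S]
    (μ : Measure Ω) [IsFiniteMeasure μ] (ℱ : Filtration ℕ mΩ)
    {W : ℕ → Ω → S} (hW : ∀ n, Measurable (W n))
    {X : ℕ → Ω → E} (hX : ∀ n, Measurable[ℱ n] (X n)) (hXr : ∀ n, (Set.range (X n)).Countable)
    {p : E → S → ℝ}
    (hp : ∀ w, Measurable fun y => p y w) (hp0 : ∀ y w, 0 ≤ p y w) (hp1 : ∀ y, ∑ w, p y w = 1)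
    (hcond : ∀ n w, μ[fun ω => if W (n + 1) ω = w then (1 : ℝ) else 0 | ℱ n]
      =ᵐ[μ] fun ω => p (X n ω) w)
    (ξ : S → E) (D : ℝ) (hD : 0 ≤ D)
    (hstep : ∀ (n : ℕ) ω, X (n + 1) ω
      = X n ω + (1 / (D + n + 1)) • (ξ (W (n + 1) ω) - X n ω))
    (hξ : ∀ w w', ‖ξ w - ξ w'‖ ≤ 1) (hX1 : ∀ n ω ω', ‖X n ω - X n ω'‖ ≤ 1)
    (B : E →L[ℝ] E →L[ℝ] ℝ) (hB : ∀ y z, B y z = B z y) {c : ℝ} (hc : 0 < c)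
    {x : E} {N : Set E} (hN : MeasurableSet N) (hNx : N ∈ nhds x)
    (h1 : ∀ n ω ω', X n ω ∈ N → X n ω' ∈ N → c * ‖X n ω - X n ω'‖ ^ 2
      ≤ ∑ z : S × S, p (X n ω) z.1 * p (X n ω') z.2 *
        B (X n ω - X n ω') (ξ z.1 - ξ z.2 - (X n ω - X n ω')))
    (h2 : ∀ n ω ω', X n ω ∈ N → X n ω' ∈ N → c
      ≤ ∑ z : S × S, p (X n ω) z.1 * p (X n ω') z.2 *
        B (ξ z.1 - ξ z.2 - (X n ω - X n ω')) (ξ z.1 - ξ z.2 - (X n ω - X n ω'))) :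
    μ {ω | Tendsto (fun n => X n ω) atTop (nhds x)} = 0 := by
  obtain ⟨q, hq0, hq1, hq⟩ := exists_measure_stay_converge_le μ ℱ hW hX hp hp0 hp1 hcond ξ D hD
    hstep hξ hX1 B hB hc hN h1 h2
  have hXm : ∀ n, Measurable[⨆ n, ℱ n] (X n) := fun n => (hX n).mono (le_iSup _ n) le_rfl
  have hle : (⨆ n, ℱ n : MeasurableSpace Ω) ≤ mΩ := iSup_le ℱ.le
  set F : ℕ → Set Ω := fun s =>
    {ω | Tendsto (fun n => X n ω) atTop (nhds x)} ∩ {ω | ∀ k, s ≤ k → X k ω ∈ N} with hF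
  have hFm : ∀ s, MeasurableSet[⨆ n, ℱ n] (F s) := by
    intro s
    refine MeasurableSet.inter ?_ ?_
    · let : MeasurableSpace Ω := ⨆ n, ℱ n
      exact measurableSet_tendsto (nhds x) hXm
    · simp only [Set.ofPred_forall]
      exact MeasurableSet.iInter fun k => MeasurableSet.iInter fun _ => hXm k hN
  have hFmono : Monotone F := fun s t hst ω hω => ⟨hω.1, fun k hk => hω.2 k (hst.trans hk)⟩
  have hcover : {ω | Tendsto (fun n => X n ω) atTop (nhds x)} ⊆ ⋃ s, F s := by
    intro ω hω
    obtain ⟨s, hs⟩ := eventually_atTop.1 (hω.eventually hNx)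
    exact Set.mem_iUnion.2 ⟨s, hω, hs⟩
  refine measure_mono_null hcover (measure_iUnion_null fun s₀ => ?_)
  set g : Ω → ℝ := (F s₀).indicator fun _ => 1 with hg
  have hFm' := hle _ (hFm s₀)
  have hgi : Integrable g μ := (integrable_const (1 : ℝ)).indicator hFm'
  have hgm : StronglyMeasurable[⨆ n, ℱ n] g := stronglyMeasurable_const.indicator (hFm s₀)
  have hlim := hgi.tendsto_ae_condExp hgm
  have hbound : ∀ s, max s₀ 1 ≤ s → ∀ᵐ ω ∂μ, (μ[g | ℱ s]) ω ≤ q := by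
    intro s hs
    have hmeas : Measurable[ℱ s] (μ[g | ℱ s]) := stronglyMeasurable_condExp.measurable
    have hA : MeasurableSet[ℱ s] {ω | q < (μ[g | ℱ s]) ω} := hmeas measurableSet_Ioi
    have hA' : ∀ y, μ ({ω | q < (μ[g | ℱ s]) ω} ∩ X s ⁻¹' {y}) = 0 := by
      intro y
      set A := {ω | q < (μ[g | ℱ s]) ω} ∩ X s ⁻¹' {y} with hAdef
      have hAm : MeasurableSet[ℱ s] A := hA.inter (hX s (measurableSet_singleton y))
      have hAm' := ℱ.le s _ hAm
      have hle1 := hq s A (A ∩ F s₀) y x ((le_max_right _ _).trans hs) hAm (hAm'.inter hFm')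
        Set.inter_subset_left (fun ω hω => hω.2)
        (fun ω hω => (hFmono ((le_max_left _ _).trans hs) hω.2).2) (fun ω hω => hω.2.1)
      have hint : ∫ ω in A, (μ[g | ℱ s]) ω ∂μ = μ.real (A ∩ F s₀) := by
        rw [setIntegral_condExp (ℱ.le s) hgi hAm, hg, setIntegral_indicator hFm',
          setIntegral_const, smul_eq_mul, mul_one]
      have hle2 : μ.real (A ∩ F s₀) ≤ q * μ.real A := by
        have := ENNReal.toReal_mono (by finiteness) hle1
        rwa [ENNReal.toReal_mul, ENNReal.toReal_ofReal hq0] at this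
      by_contra hne
      have hpos : 0 < ∫ ω in A, ((μ[g | ℱ s]) ω - q) ∂μ := by
        have hi : IntegrableOn (fun ω => (μ[g | ℱ s]) ω - q) A μ :=
          (integrable_condExp.sub (integrable_const q)).integrableOn
        rw [setIntegral_pos_iff_support_of_nonneg_ae _ hi]
        · refine (pos_iff_ne_zero.2 hne).trans_le (measure_mono fun ω hω => ⟨?_, hω⟩)
          exact (sub_pos.2 hω.1).ne'
        · filter_upwards [ae_restrict_mem hAm'] with ω hω
          exact (sub_pos.2 hω.1).le
      rw [integral_sub integrable_condExp.integrableOn (integrable_const q), hint,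
        setIntegral_const, smul_eq_mul] at hpos
      linarith
    rw [ae_iff]
    simp only [not_le]
    refine measure_mono_null (t := ⋃ y ∈ Set.range (X s),
      {ω | q < (μ[g | ℱ s]) ω} ∩ X s ⁻¹' {y}) ?_
      ((measure_biUnion_null_iff (hXr s)).2 fun y _ => hA' y)
    intro ω hω
    simp only [Set.mem_iUnion]
    exact ⟨X s ω, ⟨ω, rfl⟩, hω, rfl⟩
  have hall : ∀ᵐ ω ∂μ, ∀ s, max s₀ 1 ≤ s → (μ[g | ℱ s]) ω ≤ q := by
    rw [ae_all_iff]
    intro s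
    by_cases hs : max s₀ 1 ≤ s
    · filter_upwards [hbound s hs] with ω hω _ using hω
    · exact Eventually.of_forall fun ω h => absurd h hs
  have hfinal : ∀ᵐ ω ∂μ, ω ∉ F s₀ := by
    filter_upwards [hlim, hall] with ω hω1 hω2 hωF
    have h3 := le_of_tendsto hω1 (eventually_atTop.2 ⟨_, hω2⟩)
    rw [hg, Set.indicator_of_mem hωF] at h3
    linarith
  simpa [ae_iff] using hfinal

/-- The coordinate functional `y ↦ y i v`. -/
noncomputable def coordCLM {d m : ℕ} (i : Fin m) (v : Fin d) : (Fin m → Fin d → ℝ) →L[ℝ] ℝ :=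
  (ContinuousLinearMap.proj (R := ℝ) (φ := fun _ : Fin d => ℝ) v).comp
    (ContinuousLinearMap.proj (R := ℝ) (φ := fun _ : Fin m => Fin d → ℝ) i)

@[simp]
lemma coordCLM_apply {d m : ℕ} (i : Fin m) (v : Fin d) (y : Fin m → Fin d → ℝ) :
    coordCLM i v y = y i v := rfl

/-- The interaction functional `y ↦ ∑ j, α v i j * y j v`. -/
noncomputable def interactionCLM {d m : ℕ} (α : Fin d → Fin m → Fin m → ℝ) (i : Fin m)
    (v : Fin d) : (Fin m → Fin d → ℝ) →L[ℝ] ℝ :=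
  ∑ j, α v i j • coordCLM j v

@[simp]
lemma interactionCLM_apply {d m : ℕ} (α : Fin d → Fin m → Fin m → ℝ) (i : Fin m)
    (v : Fin d) (y : Fin m → Fin d → ℝ) :
    interactionCLM α i v y = ∑ j, α v i j * y j v := by
  simp [interactionCLM]

/-- The derivative of `FF`. -/
noncomputable def derivFF {d m : ℕ} (α : Fin d → Fin m → Fin m → ℝ) (x : Fin m → Fin d → ℝ) :
    (Fin m → Fin d → ℝ) →L[ℝ] (Fin m → Fin d → ℝ) :=
  ContinuousLinearMap.pi fun i => ContinuousLinearMap.pi fun v =>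
    -coordCLM i v + piMap d m α x i v •
      (interactionCLM α i v - ∑ u, piMap d m α x i u • interactionCLM α i u)

lemma derivFF_apply {d m : ℕ} (α : Fin d → Fin m → Fin m → ℝ) (x y : Fin m → Fin d → ℝ)
    (i : Fin m) (v : Fin d) :
    derivFF α x y i v = -y i v + piMap d m α x i v *
      (interactionCLM α i v y - ∑ u, piMap d m α x i u * interactionCLM α i u y) := by
  simp [derivFF]

lemma sum_exp_pos {d : ℕ} (hd : 2 ≤ d) (f : Fin d → ℝ) : 0 < ∑ u, Real.exp (f u) :=
  Finset.sum_pos (fun _ _ => Real.exp_pos _) ⟨⟨0, by omega⟩, Finset.mem_univ _⟩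

lemma piMap_pos {d m : ℕ} (hd : 2 ≤ d) (α : Fin d → Fin m → Fin m → ℝ)
    (x : Fin m → Fin d → ℝ) (i : Fin m) (v : Fin d) : 0 < piMap d m α x i v :=
  div_pos (Real.exp_pos _) (sum_exp_pos hd _)

lemma sum_piMap {d m : ℕ} (hd : 2 ≤ d) (α : Fin d → Fin m → Fin m → ℝ)
    (x : Fin m → Fin d → ℝ) (i : Fin m) : ∑ v, piMap d m α x i v = 1 := by
  simp only [piMap]
  rw [← Finset.sum_div, div_self (sum_exp_pos hd _).ne']

lemma hasStrictFDerivAt_FF {d m : ℕ} (hd : 2 ≤ d) (α : Fin d → Fin m → Fin m → ℝ)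
    (x : Fin m → Fin d → ℝ) : HasStrictFDerivAt (FF d m α) (derivFF α x) x := by
  rw [hasStrictFDerivAt_pi']
  intro i
  rw [hasStrictFDerivAt_pi']
  intro v
  have hexp : ∀ u, HasStrictFDerivAt (fun y => Real.exp (interactionCLM α i u y))
      (Real.exp (interactionCLM α i u x) • interactionCLM α i u) x := fun u =>
    (interactionCLM α i u).hasStrictFDerivAt.exp
  have hsum : HasStrictFDerivAt (fun y => ∑ u, Real.exp (interactionCLM α i u y))
      (∑ u, Real.exp (interactionCLM α i u x) • interactionCLM α i u) x :=
    HasStrictFDerivAt.fun_sum fun u _ => hexp u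
  have hpos := sum_exp_pos hd fun u => interactionCLM α i u x
  have hinv := (hasStrictDerivAt_inv hpos.ne').comp_hasStrictFDerivAt x hsum
  have hall := ((coordCLM i v).hasStrictFDerivAt (x := x)).neg.add ((hexp v).mul hinv)
  have hfun : (fun y => FF d m α y i v) = fun y => -coordCLM i v y +
      Real.exp (interactionCLM α i v y) * (∑ u, Real.exp (interactionCLM α i u y))⁻¹ := by
    ext y; simp [FF, piMap, div_eq_mul_inv]
  change HasStrictFDerivAt (fun y => FF d m α y i v) _ x
  rw [hfun]
  refine hall.congr_fderiv ?_
  ext y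
  change _ = derivFF α x y i v
  have hpi : ∀ u, piMap d m α x i u = Real.exp (interactionCLM α i u x) /
      ∑ u, Real.exp (interactionCLM α i u x) := fun u => by simp [piMap]
  simp only [derivFF_apply, hpi, add_apply, neg_apply, smul_apply, sum_apply, smul_eq_mul,
    coordCLM_apply, Function.comp_apply, div_mul_eq_mul_div, ← Finset.sum_div]
  field_simp
  ring

lemma continuous_piMap {d m : ℕ} (hd : 2 ≤ d) (α : Fin d → Fin m → Fin m → ℝ) (i : Fin m)
    (v : Fin d) : Continuous fun y => piMap d m α y i v := by
  unfold piMap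
  refine Continuous.div (by fun_prop) (by fun_prop) fun y => (sum_exp_pos hd _).ne'

lemma JF_apply {d m : ℕ} (hd : 2 ≤ d) (α : Fin d → Fin m → Fin m → ℝ)
    (x : Fin m → Fin d → ℝ) (p q : Fin m × Fin d) :
    JF d m α x p q = derivFF α x (Pi.single q.1 (Pi.single q.2 1)) p.1 p.2 := by
  have h := (hasStrictFDerivAt_FF hd α x).hasFDerivAt
  have h1 : HasFDerivAt (fun y => FF d m α y p.1 p.2)
      ((coordCLM p.1 p.2).comp (derivFF α x)) x :=
    (coordCLM p.1 p.2).hasFDerivAt.comp x h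
  simp [JF, h1.fderiv]

lemma sum_single_eq {d m : ℕ} (y : Fin m → Fin d → ℝ) :
    y = ∑ q : Fin m × Fin d, y q.1 q.2 • Pi.single q.1 (Pi.single q.2 (1 : ℝ)) := by
  ext i v
  rw [Fintype.sum_prod_type]
  simp [Finset.sum_apply, Pi.single_apply, apply_ite, ite_apply]

lemma derivFF_eq_sum_JF {d m : ℕ} (hd : 2 ≤ d) (α : Fin d → Fin m → Fin m → ℝ)
    (x y : Fin m → Fin d → ℝ) (p : Fin m × Fin d) :
    derivFF α x y p.1 p.2 = ∑ q : Fin m × Fin d, JF d m α x p q * y q.1 q.2 := by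
  conv_lhs => rw [sum_single_eq y]
  simp only [map_sum, map_smul, Finset.sum_apply, Pi.smul_apply, smul_eq_mul, JF_apply hd]
  exact Finset.sum_congr rfl fun q _ => mul_comm _ _

/-- The functional `y ↦ ∑ i, ∑ v, a i v * y i v`. -/
noncomputable def dotCLM {d m : ℕ} (a : Fin m → Fin d → ℝ) : (Fin m → Fin d → ℝ) →L[ℝ] ℝ :=
  ∑ i, ∑ v, a i v • coordCLM i v

lemma dotCLM_apply {d m : ℕ} (a y : Fin m → Fin d → ℝ) :
    dotCLM a y = ∑ i, ∑ v, a i v * y i v := by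
  simp [dotCLM]

lemma derivFF_injective {d m : ℕ} (hd : 2 ≤ d) (α : Fin d → Fin m → Fin m → ℝ)
    (x : Fin m → Fin d → ℝ) (hx : LinUnstable d m α x) :
    LinearMap.ker (derivFF α x).toLinearMap = ⊥ := by
  rw [LinearMap.ker_eq_bot']
  intro y hy
  by_contra hne
  refine hx.1 0 ?_ Complex.zero_re
  rw [spectrum.zero_mem_iff, Matrix.isUnit_iff_isUnit_det, isUnit_iff_ne_zero, not_not,
    ← Matrix.exists_mulVec_eq_zero_iff]
  refine ⟨fun q => (y q.1 q.2 : ℂ), ?_, ?_⟩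
  · intro h
    refine hne (funext fun i => funext fun v => ?_)
    simpa using congrFun h (i, v)
  · ext p
    have h1 : derivFF α x y p.1 p.2 = 0 := by
      have : derivFF α x y = 0 := hy
      rw [this]; rfl
    rw [derivFF_eq_sum_JF hd] at h1
    simp only [Matrix.mulVec, dotProduct, Matrix.map_apply, Complex.coe_algebraMap,
      Pi.zero_apply]
    exact_mod_cast h1

/-- The real and imaginary parts of a left eigenvector of the Jacobian matrix for an eigenvalue
with positive real part. -/
lemma exists_left_eigenvector {d m : ℕ} (hd : 2 ≤ d) (α : Fin d → Fin m → Fin m → ℝ)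
    (x : Fin m → Fin d → ℝ) (hx : LinUnstable d m α x) :
    ∃ (ρ σ : ℝ) (a b : Fin m → Fin d → ℝ), 0 < ρ ∧ (a ≠ 0 ∨ b ≠ 0) ∧
      (∀ y, dotCLM a (derivFF α x y) = ρ * dotCLM a y - σ * dotCLM b y) ∧
      ∀ y, dotCLM b (derivFF α x y) = ρ * dotCLM b y + σ * dotCLM a y := by
  obtain ⟨μ, hμ, hpos⟩ := hx.2
  rw [spectrum.mem_iff, Matrix.isUnit_iff_isUnit_det, isUnit_iff_ne_zero, not_not,
    ← Matrix.exists_vecMul_eq_zero_iff] at hμ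
  obtain ⟨l, hl0, hl⟩ := hμ
  have heig : ∀ q, ∑ p, l p * (JF d m α x p q : ℂ) = μ * l q := by
    intro q
    have h := congrFun hl q
    rw [Matrix.vecMul_sub, Pi.sub_apply, Pi.zero_apply, sub_eq_zero,
      Algebra.algebraMap_eq_smul_one, Matrix.vecMul_smul, Matrix.vecMul_one, Pi.smul_apply,
      smul_eq_mul] at h
    rw [h]
    simp [Matrix.vecMul, dotProduct]
  have hdot : ∀ (c : Fin m × Fin d → ℝ) y, dotCLM (fun i v => c (i, v)) (derivFF α x y)
      = ∑ q : Fin m × Fin d, (∑ p, c p * JF d m α x p q) * y q.1 q.2 := by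
    intro c y
    rw [dotCLM_apply, ← Fintype.sum_prod_type' fun i v => c (i, v) * derivFF α x y i v]
    simp_rw [derivFF_eq_sum_JF hd, Finset.mul_sum, Finset.sum_mul]
    rw [Finset.sum_comm]
    exact Finset.sum_congr rfl fun q _ => Finset.sum_congr rfl fun p _ => by ring
  have hre : ∀ q, ∑ p, (l p).re * JF d m α x p q = μ.re * (l q).re - μ.im * (l q).im := by
    intro q
    have := congrArg Complex.re (heig q)
    simpa [Complex.re_sum, Complex.mul_re] using this
  have him : ∀ q, ∑ p, (l p).im * JF d m α x p q = μ.re * (l q).im + μ.im * (l q).re := by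
    intro q
    have := congrArg Complex.im (heig q)
    simpa [Complex.im_sum, Complex.mul_im] using this
  have hdot' : ∀ (c : Fin m × Fin d → ℝ) y, dotCLM (fun i v => c (i, v)) y
      = ∑ q : Fin m × Fin d, c q * y q.1 q.2 := fun c y => by
    rw [dotCLM_apply, ← Fintype.sum_prod_type' fun i v => c (i, v) * y i v]
  refine ⟨μ.re, μ.im, fun i v => (l (i, v)).re, fun i v => (l (i, v)).im, hpos, ?_, ?_, ?_⟩
  · by_contra! h
    refine hl0 (funext fun p => Complex.ext ?_ ?_)
    · exact congrFun (congrFun h.1 p.1) p.2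
    · exact congrFun (congrFun h.2 p.1) p.2
  · intro y
    rw [hdot fun p => (l p).re, hdot' fun p => (l p).re, hdot' fun p => (l p).im,
      Finset.mul_sum, Finset.mul_sum, ← Finset.sum_sub_distrib]
    exact Finset.sum_congr rfl fun q _ => by rw [hre]; ring
  · intro y
    rw [hdot fun p => (l p).im, hdot' fun p => (l p).re, hdot' fun p => (l p).im,
      Finset.mul_sum, Finset.mul_sum, ← Finset.sum_add_distrib]
    exact Finset.sum_congr rfl fun q _ => by rw [him]; ring

/-- The Hessian of the free energy at an equilibrium `x`. -/
noncomputable def hessForm {d m : ℕ} (α : Fin d → Fin m → Fin m → ℝ) (x : Fin m → Fin d → ℝ) :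
    (Fin m → Fin d → ℝ) →L[ℝ] (Fin m → Fin d → ℝ) →L[ℝ] ℝ :=
  ∑ i, ∑ v, (coordCLM i v).smulRight (interactionCLM α i v - (x i v)⁻¹ • coordCLM i v)

lemma hessForm_apply {d m : ℕ} (α : Fin d → Fin m → Fin m → ℝ) (x y z : Fin m → Fin d → ℝ) :
    hessForm α x y z = ∑ i, ∑ v, y i v * (interactionCLM α i v z - (x i v)⁻¹ * z i v) := by
  simp [hessForm, sum_apply]

lemma hessForm_symm {d m : ℕ} {α : Fin d → Fin m → Fin m → ℝ}
    (hsym : ∀ v i j, α v i j = α v j i) (x y z : Fin m → Fin d → ℝ) :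
    hessForm α x y z = hessForm α x z y := by
  have h : ∀ y z : Fin m → Fin d → ℝ, hessForm α x y z
      = ∑ v, ∑ i, ∑ j, α v i j * y i v * z j v - ∑ i, ∑ v, (x i v)⁻¹ * (y i v * z i v) := by
    intro y z
    rw [hessForm_apply, Finset.sum_comm (s := Finset.univ (α := Fin d)),
      ← Finset.sum_sub_distrib]
    refine Finset.sum_congr rfl fun i _ => ?_
    rw [← Finset.sum_sub_distrib]
    refine Finset.sum_congr rfl fun v _ => ?_
    rw [interactionCLM_apply, mul_sub, Finset.mul_sum]
    congr 1
    · exact Finset.sum_congr rfl fun j _ => by ring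
    · ring
  rw [h, h]
  congr 1
  · refine Finset.sum_congr rfl fun v _ => ?_
    rw [Finset.sum_comm]
    exact Finset.sum_congr rfl fun i _ => Finset.sum_congr rfl fun j _ => by
      rw [hsym v j i]; ring
  · exact Finset.sum_congr rfl fun i _ => Finset.sum_congr rfl fun v _ => by ring

lemma sum_derivFF {d m : ℕ} (hd : 2 ≤ d) (α : Fin d → Fin m → Fin m → ℝ)
    (x y : Fin m → Fin d → ℝ) (i : Fin m) :
    ∑ v, derivFF α x y i v = -∑ v, y i v := by
  simp only [derivFF_apply, Finset.sum_add_distrib, Finset.sum_neg_distrib, mul_sub,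
    Finset.sum_sub_distrib, ← Finset.sum_mul, sum_piMap hd]
  ring

lemma hessForm_derivFF {d m : ℕ} (hd : 2 ≤ d) {α : Fin d → Fin m → Fin m → ℝ}
    (hsym : ∀ v i j, α v i j = α v j i) {x : Fin m → Fin d → ℝ} (hx : piMap d m α x = x)
    {y : Fin m → Fin d → ℝ} (hy : ∀ i, ∑ v, y i v = 0) :
    hessForm α x y (derivFF α x y) = ∑ i, ∑ v, (derivFF α x y i v) ^ 2 / x i v := by
  rw [hessForm_symm hsym, hessForm_apply]
  refine Finset.sum_congr rfl fun i _ => ?_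
  set μ := ∑ u, piMap d m α x i u * interactionCLM α i u y with hμ
  have h : ∀ v, derivFF α x y i v * (interactionCLM α i v y - (x i v)⁻¹ * y i v)
      = (derivFF α x y i v) ^ 2 / x i v + derivFF α x y i v * μ := by
    intro v
    have hpos : x i v ≠ 0 := hx ▸ (piMap_pos hd α x i v).ne'
    have hw := derivFF_apply α x y i v
    rw [← hμ, hx] at hw
    have : interactionCLM α i v y = (derivFF α x y i v + y i v) / x i v + μ := by
      rw [hw]; field_simp; ring
    rw [this]
    field_simp
    ring
  simp_rw [h]
  rw [Finset.sum_add_distrib, ← Finset.sum_mul, sum_derivFF hd, hy i]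
  ring

lemma sq_norm_le_sum {d m : ℕ} {x : Fin m → Fin d → ℝ} (hx0 : ∀ i v, 0 < x i v)
    (hx1 : ∀ i v, x i v ≤ 1) (w : Fin m → Fin d → ℝ) :
    ‖w‖ ^ 2 ≤ ∑ i, ∑ v, (w i v) ^ 2 / x i v := by
  have hterm : ∀ i v, 0 ≤ (w i v) ^ 2 / x i v := fun i v => div_nonneg (sq_nonneg _) (hx0 i v).le
  have hR : 0 ≤ ∑ i, ∑ v, (w i v) ^ 2 / x i v :=
    Finset.sum_nonneg fun i _ => Finset.sum_nonneg fun v _ => hterm i v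
  rw [← Real.le_sqrt (norm_nonneg _) hR]
  refine (pi_norm_le_iff_of_nonneg (Real.sqrt_nonneg _)).2 fun i =>
    (pi_norm_le_iff_of_nonneg (Real.sqrt_nonneg _)).2 fun v => ?_
  rw [Real.norm_eq_abs]
  refine Real.abs_le_sqrt ?_
  calc (w i v) ^ 2 ≤ (w i v) ^ 2 / x i v := by
        rw [le_div_iff₀ (hx0 i v)]
        exact mul_le_of_le_one_right (sq_nonneg _) (hx1 i v)
    _ ≤ ∑ v, (w i v) ^ 2 / x i v :=
        Finset.single_le_sum (f := fun v => (w i v) ^ 2 / x i v)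
          (fun v _ => hterm i v) (Finset.mem_univ v)
    _ ≤ _ := Finset.single_le_sum (f := fun i => ∑ v, (w i v) ^ 2 / x i v)
          (fun i _ => Finset.sum_nonneg fun v _ => hterm i v) (Finset.mem_univ i)

/-- The position of the vertices `w` as a point of the product of simplices. -/
def vertexPoint {d m : ℕ} (w : Fin m → Fin d) : Fin m → Fin d → ℝ :=
  fun i v => if w i = v then 1 else 0

/-- The joint transition probability. -/
noncomputable def jointProb {d m : ℕ} (α : Fin d → Fin m → Fin m → ℝ) (x : Fin m → Fin d → ℝ)
    (w : Fin m → Fin d) : ℝ :=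
  ∏ i, piMap d m α x i (w i)

lemma jointProb_pos {d m : ℕ} (hd : 2 ≤ d) (α : Fin d → Fin m → Fin m → ℝ)
    (x : Fin m → Fin d → ℝ) (w : Fin m → Fin d) : 0 < jointProb α x w :=
  Finset.prod_pos fun i _ => piMap_pos hd α x i (w i)

lemma continuous_jointProb {d m : ℕ} (hd : 2 ≤ d) (α : Fin d → Fin m → Fin m → ℝ)
    (w : Fin m → Fin d) : Continuous fun x => jointProb α x w :=
  continuous_finsetProd _ fun i _ => continuous_piMap hd α i (w i)

lemma sum_jointProb {d m : ℕ} (hd : 2 ≤ d) (α : Fin d → Fin m → Fin m → ℝ)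
    (x : Fin m → Fin d → ℝ) : ∑ w, jointProb α x w = 1 := by
  simp only [jointProb]
  rw [← Fintype.prod_sum]
  simp [sum_piMap hd]

lemma sum_jointProb_smul {d m : ℕ} (hd : 2 ≤ d) (α : Fin d → Fin m → Fin m → ℝ)
    (x : Fin m → Fin d → ℝ) : ∑ w, jointProb α x w • vertexPoint w = piMap d m α x := by
  ext i v
  simp only [Finset.sum_apply, Pi.smul_apply, smul_eq_mul, vertexPoint, jointProb]
  have h : ∀ w : Fin m → Fin d, (∏ j, piMap d m α x j (w j)) * (if w i = v then (1 : ℝ) else 0)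
      = ∏ j, (piMap d m α x j (w j) * if j = i then (if w j = v then 1 else 0) else 1) := by
    intro w
    rw [Finset.prod_mul_distrib]
    congr 1
    rw [Finset.prod_ite_eq' Finset.univ i fun j => if w j = v then (1 : ℝ) else 0]
    simp
  simp_rw [h]
  rw [← Fintype.prod_sum fun j u =>
    piMap d m α x j u * if j = i then (if u = v then (1 : ℝ) else 0) else 1]
  rw [Finset.prod_eq_single i]
  · simp
  · intro j _ hj
    simp [hj, sum_piMap hd]
  · simp

lemma sum_jointProb_sub {d m : ℕ} (hd : 2 ≤ d) (α : Fin d → Fin m → Fin m → ℝ)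
    (φ : (Fin m → Fin d → ℝ) →L[ℝ] ℝ) (y z : Fin m → Fin d → ℝ) :
    ∑ w : (Fin m → Fin d) × (Fin m → Fin d), jointProb α y w.1 * jointProb α z w.2 *
      φ (vertexPoint w.1 - vertexPoint w.2 - (y - z)) = φ (FF d m α y - FF d m α z) := by
  have hF : FF d m α y - FF d m α z = ∑ w, jointProb α y w • vertexPoint w
      - ∑ w, jointProb α z w • vertexPoint w - (y - z) := by
    rw [sum_jointProb_smul hd, sum_jointProb_smul hd]
    ext i v
    simp [FF]; ring
  rw [hF, Fintype.sum_prod_type]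
  simp only [map_sub, map_sum, map_smul, smul_eq_mul, mul_sub, Finset.sum_sub_distrib]
  have e1 : ∀ f : (Fin m → Fin d) → ℝ, ∑ w, ∑ w', jointProb α y w * jointProb α z w' * f w
      = ∑ w, jointProb α y w * f w := fun f => Finset.sum_congr rfl fun w _ => by
    rw [← Finset.sum_mul, ← Finset.mul_sum, sum_jointProb hd, mul_one]
  have e2 : ∀ f : (Fin m → Fin d) → ℝ, ∑ w, ∑ w', jointProb α y w * jointProb α z w' * f w'
      = ∑ w', jointProb α z w' * f w' := fun f => by
    simp_rw [mul_assoc]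
    simp_rw [← Finset.mul_sum]
    rw [← Finset.sum_mul, sum_jointProb hd, one_mul]
  rw [e1 fun w => φ (vertexPoint w), e2 fun w => φ (vertexPoint w), e1 fun _ => φ y,
    e1 fun _ => φ z, ← Finset.sum_mul, ← Finset.sum_mul, sum_jointProb hd, one_mul, one_mul]

/-- The noise is not degenerate in the directions of an unstable left eigenvector. -/
lemma exists_vertexPoint_ne {d m : ℕ} (hd : 2 ≤ d) (α : Fin d → Fin m → Fin m → ℝ)
    (x : Fin m → Fin d → ℝ) {ρ σ : ℝ} {a b : Fin m → Fin d → ℝ} (hρ : 0 < ρ)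
    (hab : a ≠ 0 ∨ b ≠ 0)
    (ha : ∀ y, dotCLM a (derivFF α x y) = ρ * dotCLM a y - σ * dotCLM b y)
    (hb : ∀ y, dotCLM b (derivFF α x y) = ρ * dotCLM b y + σ * dotCLM a y) :
    ∃ w w', dotCLM a (vertexPoint w - vertexPoint w') ≠ 0 ∨
      dotCLM b (vertexPoint w - vertexPoint w') ≠ 0 := by
  by_contra! h
  have hdot : ∀ (c : Fin m → Fin d → ℝ) w, dotCLM c (vertexPoint w) = ∑ i, c i (w i) := by
    intro c w
    simp [dotCLM_apply, vertexPoint]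
  have hconst : ∀ c : Fin m → Fin d → ℝ, (∀ w w', dotCLM c (vertexPoint w - vertexPoint w') = 0) →
      ∀ i u v, c i u = c i v := by
    intro c hc i u v
    have h1 := hc (Function.update (fun _ => u) i v) fun _ => u
    rw [map_sub, hdot, hdot, ← Finset.sum_sub_distrib, Finset.sum_eq_single i] at h1
    · simp at h1; linarith
    · intro j _ hj; simp [hj]
    · simp
  have htan : ∀ c : Fin m → Fin d → ℝ, (∀ w w', dotCLM c (vertexPoint w - vertexPoint w') = 0) →
      ∀ y, dotCLM c (derivFF α x y) = -dotCLM c y := by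
    intro c hc y
    rw [dotCLM_apply, dotCLM_apply, ← Finset.sum_neg_distrib]
    refine Finset.sum_congr rfl fun i _ => ?_
    have e : ∀ z : Fin m → Fin d → ℝ, ∑ v, c i v * z i v = c i ⟨0, by omega⟩ * ∑ v, z i v := by
      intro z
      rw [Finset.mul_sum]
      exact Finset.sum_congr rfl fun v _ => by rw [hconst c hc i v ⟨0, by omega⟩]
    rw [e, e, sum_derivFF hd]
    ring
  have hzero : ∀ y, dotCLM a y = 0 ∧ dotCLM b y = 0 := by
    intro y
    have h1 := htan a (fun w w' => (h w w').1) y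
    have h2 := htan b (fun w w' => (h w w').2) y
    rw [ha] at h1
    rw [hb] at h2
    have h3 : (ρ + 1) * (dotCLM a y ^ 2 + dotCLM b y ^ 2) = 0 := by
      linear_combination dotCLM a y * h1 + dotCLM b y * h2
    have h4 : dotCLM a y ^ 2 + dotCLM b y ^ 2 = 0 :=
      (mul_eq_zero.1 h3).resolve_left (by positivity)
    exact ⟨by nlinarith [sq_nonneg (dotCLM a y), sq_nonneg (dotCLM b y)],
      by nlinarith [sq_nonneg (dotCLM a y), sq_nonneg (dotCLM b y)]⟩
  have hext : ∀ c : Fin m → Fin d → ℝ, (∀ y, dotCLM c y = 0) → c = 0 := by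
    intro c hc
    ext i v
    have := hc (Pi.single i (Pi.single v 1))
    rw [dotCLM_apply, Finset.sum_eq_single i (fun j _ hj => by simp [hj]) (by simp)] at this
    simpa [Pi.single_apply] using this
  rcases hab with h' | h'
  · exact h' (hext a fun y => (hzero y).1)
  · exact h' (hext b fun y => (hzero y).2)

/-- The expectation of `B η η` for the difference `η` of the centred increments from `y` and `z`. -/
noncomputable def pairNoise {d m : ℕ} (α : Fin d → Fin m → Fin m → ℝ)
    (B : (Fin m → Fin d → ℝ) →L[ℝ] (Fin m → Fin d → ℝ) →L[ℝ] ℝ) (y z : Fin m → Fin d → ℝ) : ℝ :=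
  ∑ w : (Fin m → Fin d) × (Fin m → Fin d), jointProb α y w.1 * jointProb α z w.2 *
    B (vertexPoint w.1 - vertexPoint w.2 - (y - z)) (vertexPoint w.1 - vertexPoint w.2 - (y - z))

lemma continuous_pairNoise {d m : ℕ} (hd : 2 ≤ d) (α : Fin d → Fin m → Fin m → ℝ)
    (B : (Fin m → Fin d → ℝ) →L[ℝ] (Fin m → Fin d → ℝ) →L[ℝ] ℝ) :
    Continuous fun q : (Fin m → Fin d → ℝ) × (Fin m → Fin d → ℝ) => pairNoise α B q.1 q.2 := by
  refine continuous_finsetSum _ fun w _ => ?_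
  have h1 := (continuous_jointProb hd α w.1).comp (continuous_fst (X := Fin m → Fin d → ℝ)
    (Y := Fin m → Fin d → ℝ))
  have h2 := (continuous_jointProb hd α w.2).comp (continuous_snd (X := Fin m → Fin d → ℝ)
    (Y := Fin m → Fin d → ℝ))
  refine (h1.mul h2).mul ?_
  fun_prop

lemma eventually_le_of_derivFF {d m : ℕ} (hd : 2 ≤ d) (α : Fin d → Fin m → Fin m → ℝ)
    (x : Fin m → Fin d → ℝ) (B : (Fin m → Fin d → ℝ) →L[ℝ] (Fin m → Fin d → ℝ) →L[ℝ] ℝ)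
    {c : ℝ} (hc : 0 < c)
    (hB : ∀ y : Fin m → Fin d → ℝ, (∀ i, ∑ v, y i v = 0) → c * ‖y‖ ^ 2 ≤ B y (derivFF α x y)) :
    ∀ᶠ q : (Fin m → Fin d → ℝ) × (Fin m → Fin d → ℝ) in nhds (x, x),
      (∀ i, ∑ v, (q.1 - q.2) i v = 0) →
        c / 2 * ‖q.1 - q.2‖ ^ 2 ≤ B (q.1 - q.2) (FF d m α q.1 - FF d m α q.2) := by
  have hε : 0 < c / (2 * (‖B‖ + 1)) := by positivity
  filter_upwards [(hasStrictFDerivAt_FF hd α x).isLittleO.bound hε] with q hq h0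
  have h1 := hB _ h0
  set y := q.1 - q.2
  set r := FF d m α q.1 - FF d m α q.2 - derivFF α x y with hr
  have hsplit : B y (FF d m α q.1 - FF d m α q.2) = B y (derivFF α x y) + B y r := by
    rw [← map_add, hr]; congr 1; abel
  have h2 : ‖B y r‖ ≤ c / 2 * ‖y‖ ^ 2 := by
    calc ‖B y r‖ ≤ ‖B‖ * ‖y‖ * ‖r‖ := B.le_opNorm₂ y r
      _ ≤ (‖B‖ + 1) * ‖y‖ * (c / (2 * (‖B‖ + 1)) * ‖y‖) := by gcongr; linarith
      _ = c / 2 * ‖y‖ ^ 2 := by field_simp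
  have := neg_le_of_abs_le ((Real.norm_eq_abs _).symm.le.trans h2)
  rw [hsplit]
  linarith

lemma exists_expanding_form {d m : ℕ} (hd : 2 ≤ d) {α : Fin d → Fin m → Fin m → ℝ}
    (hsym : ∀ v i j, α v i j = α v j i) {x : Fin m → Fin d → ℝ} (hx : x ∈ simplexD d m)
    (hxeq : FF d m α x = 0) (hxunstable : LinUnstable d m α x) :
    ∃ B : (Fin m → Fin d → ℝ) →L[ℝ] (Fin m → Fin d → ℝ) →L[ℝ] ℝ, (∀ y z, B y z = B z y) ∧
      ∃ c > 0, ∃ N, IsOpen N ∧ x ∈ N ∧ ∀ y ∈ N, ∀ z ∈ N, c ≤ pairNoise α B y z ∧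
        ((∀ i, ∑ v, (y - z) i v = 0) →
          c * ‖y - z‖ ^ 2 ≤ B (y - z) (FF d m α y - FF d m α z)) := by
  have hpx : piMap d m α x = x := by
    ext i v
    have := congrFun (congrFun hxeq i) v
    simp only [FF, Pi.zero_apply] at this
    linarith
  have hx0 : ∀ i v, 0 < x i v := fun i v => hpx ▸ piMap_pos hd α x i v
  have hx1 : ∀ i v, x i v ≤ 1 := fun i v => (hx i).2 ▸
    Finset.single_le_sum (f := x i) (fun u _ => (hx i).1 u) (Finset.mem_univ v)
  obtain ⟨ρ, σ, a, b, hρ, hab, ha, hb⟩ := exists_left_eigenvector hd α x hxunstable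
  obtain ⟨w₁, w₂, hw⟩ := exists_vertexPoint_ne hd α x hρ hab ha hb
  set R : (Fin m → Fin d → ℝ) →L[ℝ] (Fin m → Fin d → ℝ) →L[ℝ] ℝ :=
    (dotCLM a).smulRight (dotCLM a) + (dotCLM b).smulRight (dotCLM b) with hR
  have hRapp : ∀ y z, R y z = dotCLM a y * dotCLM a z + dotCLM b y * dotCLM b z := fun y z => by
    simp [hR]
  have hRnn : ∀ y, 0 ≤ R y y := fun y => by
    rw [hRapp]; exact add_nonneg (mul_self_nonneg _) (mul_self_nonneg _)
  have hτ : 0 < pairNoise α R x x := by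
    refine Finset.sum_pos' (fun w _ => mul_nonneg (mul_pos (jointProb_pos hd α x _)
      (jointProb_pos hd α x _)).le (hRnn _)) ⟨(w₁, w₂), Finset.mem_univ _,
      mul_pos (mul_pos (jointProb_pos hd α x _) (jointProb_pos hd α x _)) ?_⟩
    rw [sub_self, sub_zero, hRapp]
    rcases hw with h | h
    · exact add_pos_of_pos_of_nonneg (mul_self_pos.2 h) (mul_self_nonneg _)
    · exact add_pos_of_nonneg_of_pos (mul_self_nonneg _) (mul_self_pos.2 h)
  set K : ℝ := (|pairNoise α (hessForm α x) x x| + 1) / pairNoise α R x x with hK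
  have hK0 : 0 ≤ K := by positivity
  set B := hessForm α x + K • R with hB
  have hnoise : 1 ≤ pairNoise α B x x := by
    have : pairNoise α B x x = pairNoise α (hessForm α x) x x + K * pairNoise α R x x := by
      simp only [pairNoise, hB, add_apply, smul_apply, smul_eq_mul, mul_add,
        Finset.sum_add_distrib, Finset.mul_sum]
      congr 1
      exact Finset.sum_congr rfl fun w _ => by ring
    rw [this, hK, div_mul_cancel₀ _ hτ.ne']
    linarith [neg_abs_le (pairNoise α (hessForm α x) x x)]
  obtain ⟨C, hC0, hC⟩ := (derivFF α x).toLinearMap.exists_antilipschitzWith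
    (derivFF_injective hd α x hxunstable)
  have hC0' : (0 : ℝ) < C := hC0
  have hexp : ∀ y : Fin m → Fin d → ℝ, (∀ i, ∑ v, y i v = 0) →
      1 / (C : ℝ) ^ 2 * ‖y‖ ^ 2 ≤ B y (derivFF α x y) := by
    intro y hy
    have h1 : ‖y‖ ≤ C * ‖derivFF α x y‖ := by
      simpa [dist_zero_right] using hC.le_mul_dist y 0
    have h2 : 1 / (C : ℝ) ^ 2 * ‖y‖ ^ 2 ≤ ‖derivFF α x y‖ ^ 2 := by
      rw [one_div, inv_mul_le_iff₀ (by positivity), ← mul_pow]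
      gcongr
    have h3 : B y (derivFF α x y) = hessForm α x y (derivFF α x y) + K * (ρ * R y y) := by
      simp only [hB, add_apply, smul_apply, smul_eq_mul, hRapp, ha, hb]
      ring
    rw [h3, hessForm_derivFF hd hsym hpx hy]
    linarith [sq_norm_le_sum hx0 hx1 (derivFF α x y),
      mul_nonneg hK0 (mul_nonneg hρ.le (hRnn y))]
  have hnear : ∀ᶠ q : (Fin m → Fin d → ℝ) × (Fin m → Fin d → ℝ) in nhds (x, x),
      1 / 2 < pairNoise α B q.1 q.2 :=
    (continuous_pairNoise hd α B).continuousAt.eventually (lt_mem_nhds (by norm_num; linarith))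
  have hall := hnear.and (eventually_le_of_derivFF hd α x B (by positivity) hexp)
  rw [nhds_prod_eq] at hall
  obtain ⟨N, hN, hNall⟩ := eventually_prod_self_iff'.1 hall
  refine ⟨B, fun y z => ?_, min (1 / 2) (1 / (C : ℝ) ^ 2 / 2), by positivity, interior N,
    isOpen_interior, mem_interior_iff_mem_nhds.2 hN, fun y hy z hz => ?_⟩
  · simp only [hB, add_apply, smul_apply, hRapp, hessForm_symm hsym x y z]
    ring_nf
  · obtain ⟨h1, h2⟩ := hNall y (interior_subset hy) z (interior_subset hz)
    refine ⟨(min_le_left _ _).trans h1.le, fun h0 => le_trans ?_ (h2 h0)⟩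
    gcongr
    exact min_le_right _ _

lemma sum_occ {d m : ℕ} (hd : 2 ≤ d) {Ω : Type*} (W : ℕ → Ω → Fin m → Fin d) (n : ℕ) (ω : Ω)
    (i : Fin m) : ∑ v, occ d m W n ω i v = 1 := by
  have hd' : (0 : ℝ) < d := by exact_mod_cast (by omega : 0 < d)
  simp only [occ]
  rw [← Finset.sum_div, Finset.sum_add_distrib, Finset.sum_comm]
  simp only [Finset.sum_ite_eq, Finset.mem_univ, if_true, Finset.sum_const, Finset.card_univ,
    Fintype.card_fin, Nat.card_Icc, nsmul_eq_mul, mul_one, Nat.add_sub_cancel]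
  exact div_self (by positivity)

lemma occ_nonneg {d m : ℕ} {Ω : Type*} (W : ℕ → Ω → Fin m → Fin d) (n : ℕ) (ω : Ω) (i : Fin m)
    (v : Fin d) : 0 ≤ occ d m W n ω i v := by
  refine div_nonneg (add_nonneg zero_le_one (Finset.sum_nonneg fun k _ => ?_)) (by positivity)
  split_ifs <;> norm_num

lemma occ_le_one {d m : ℕ} (hd : 2 ≤ d) {Ω : Type*} (W : ℕ → Ω → Fin m → Fin d) (n : ℕ) (ω : Ω)
    (i : Fin m) (v : Fin d) : occ d m W n ω i v ≤ 1 :=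
  sum_occ hd W n ω i ▸ Finset.single_le_sum (f := occ d m W n ω i)
    (fun u _ => occ_nonneg W n ω i u) (Finset.mem_univ v)

lemma occ_succ {d m : ℕ} (hd : 2 ≤ d) {Ω : Type*} (W : ℕ → Ω → Fin m → Fin d) (n : ℕ) (ω : Ω) :
    occ d m W (n + 1) ω = occ d m W n ω
      + (1 / ((d : ℝ) + n + 1)) • (vertexPoint (W (n + 1) ω) - occ d m W n ω) := by
  have hd' : (0 : ℝ) < d := by exact_mod_cast (by omega : 0 < d)
  ext i v
  simp only [Pi.add_apply, Pi.smul_apply, Pi.sub_apply, smul_eq_mul, vertexPoint, occ]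
  rw [Finset.sum_Icc_succ_top (by omega)]
  push_cast
  field_simp
  ring

lemma norm_sub_le_one_of_mem_Icc {d m : ℕ} {y z : Fin m → Fin d → ℝ}
    (hy : ∀ i v, y i v ∈ Set.Icc (0 : ℝ) 1) (hz : ∀ i v, z i v ∈ Set.Icc (0 : ℝ) 1) :
    ‖y - z‖ ≤ 1 := by
  refine (pi_norm_le_iff_of_nonneg zero_le_one).2 fun i =>
    (pi_norm_le_iff_of_nonneg zero_le_one).2 fun v => ?_
  rw [Pi.sub_apply, Pi.sub_apply, Real.norm_eq_abs, abs_le]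
  constructor <;> linarith [(hy i v).1, (hy i v).2, (hz i v).1, (hz i v).2]

lemma countable_range_occ {d m : ℕ} {Ω : Type*} (W : ℕ → Ω → Fin m → Fin d) (n : ℕ) :
    (Set.range (occ d m W n)).Countable := by
  refine (Set.countable_range fun (N : Fin m → Fin d → ℕ) (i : Fin m) (v : Fin d) =>
    (1 + (N i v : ℝ)) / (d + n)).mono ?_
  rintro _ ⟨ω, rfl⟩
  exact ⟨fun i v => ∑ k ∈ Finset.Icc 1 n, if W k ω i = v then 1 else 0, by
    ext i v; simp [occ]⟩

lemma measurable_occ {d m : ℕ} {Ω : Type*} [MeasurableSpace Ω] {W : ℕ → Ω → Fin m → Fin d}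
    {n : ℕ} (hW : ∀ k ∈ Finset.Icc 1 n, Measurable (W k)) : Measurable (occ d m W n) := by
  refine measurable_pi_lambda _ fun i => measurable_pi_lambda _ fun v => ?_
  refine (measurable_const.add (Finset.measurable_fun_sum _ fun k hk => ?_)).div_const _
  exact (measurable_of_finite fun w : Fin m → Fin d =>
    if w i = v then (1 : ℝ) else 0).comp (hW k hk)

/-- For each linearly unstable equilibrium point `x` of `F`, the vertex occupation measure
process converges to `x` with probability zero. -/
theorem no_convergence_to_unstable_equilibrium (d m : ℕ) (hd : 2 ≤ d) (hm : 2 ≤ m)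
    (α : Fin d → Fin m → Fin m → ℝ) (hsym : ∀ v i j, α v i j = α v j i)
    {Ω : Type*} [MeasurableSpace Ω] (ℙ : Measure Ω) [IsProbabilityMeasure ℙ]
    (W : ℕ → Ω → Fin m → Fin d) (hWmeas : ∀ n, Measurable (W n))
    (ℱ : Filtration ℕ ‹MeasurableSpace Ω›)
    (hℱ : ∀ n, ℱ n = ⨆ k ∈ Finset.Icc 1 n, MeasurableSpace.comap (W k) ⊤)
    (hcond : ∀ n (i : Fin m) (v : Fin d),
      (ℙ[fun ω => if W (n + 1) ω i = v then (1 : ℝ) else 0 | ℱ n])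
        =ᵐ[ℙ] fun ω => piMap d m α (occ d m W n ω) i v)
    (hindep : ∀ n (v : Fin m → Fin d),
      (ℙ[fun ω => if (∀ i, W (n + 1) ω i = v i) then (1 : ℝ) else 0 | ℱ n])
        =ᵐ[ℙ] fun ω => ∏ i, piMap d m α (occ d m W n ω) i (v i))
    (x : Fin m → Fin d → ℝ) (hx : x ∈ simplexD d m)
    (hxeq : FF d m α x = 0) (hxunstable : LinUnstable d m α x) :
    ℙ {ω | Tendsto (fun n => occ d m W n ω) atTop (nhds x)} = 0 := by
  obtain ⟨B, hB, c, hc, N, hN, hxN, hexp⟩ := exists_expanding_form hd hsym hx hxeq hxunstable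
  have hocc : ∀ n ω i v, occ d m W n ω i v ∈ Set.Icc (0 : ℝ) 1 := fun n ω i v =>
    ⟨occ_nonneg W n ω i v, occ_le_one hd W n ω i v⟩
  have hvert : ∀ (w : Fin m → Fin d) i v, vertexPoint w i v ∈ Set.Icc (0 : ℝ) 1 := by
    intro w i v
    unfold vertexPoint
    split_ifs <;> simp
  refine measure_tendsto_eq_zero_of_expanding (p := jointProb α) ℙ ℱ hWmeas ?_
    (countable_range_occ W) (fun w => (continuous_jointProb hd α w).measurable)
    (fun y w => (jointProb_pos hd α y w).le) (sum_jointProb hd α) ?_ vertexPoint d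
    (Nat.cast_nonneg d) (occ_succ hd W)
    (fun w w' => norm_sub_le_one_of_mem_Icc (hvert w) (hvert w'))
    (fun n ω ω' => norm_sub_le_one_of_mem_Icc (hocc n ω) (hocc n ω')) B hB hc hN.measurableSet
    (hN.mem_nhds hxN) ?_ ?_
  · intro n
    refine @measurable_occ d m Ω (ℱ n) W n fun k hk => ?_
    rw [hℱ, measurable_iff_comap_le]
    exact (MeasurableSpace.comap_mono le_top).trans
      (le_iSup₂ (f := fun k (_ : k ∈ Finset.Icc 1 n) => MeasurableSpace.comap (W k) ⊤) k hk)
  · intro n w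
    simpa only [funext_iff, jointProb] using hindep n w
  · intro n ω ω' h h'
    rw [sum_jointProb_sub hd]
    refine (hexp _ h _ h').2 fun i => ?_
    simp [Finset.sum_sub_distrib, sum_occ hd]
  · exact fun n ω ω' h h' => (hexp _ h _ h').1
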